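/- arXiv:2207.03908 — 6 statements merged into one kernel-verified Lean document; each statement's English description precedes it below -/
import Mathlib

section
/- Let κ be a pre-Kupisch function on an interval I ⊆ ℝ, and let c ∈ ℝ be a point with (c − ε, c) ⊆ I for some ε > 0, such that κ(t) tends to 0 as t tends to c from the left. Then K(t) ≤ c for all t ∈ I with t < c. Furthermore, if K(t₀) = c for some t₀ ∈ I with t₀ < c, then K(t) = c for all t ∈ [t₀, c). -/
/-- A pre-Kupisch function on an interval `I ⊆ ℝ` (a nonempty order-connected set):
a real-valued function `κ` which is positive on `I`, such that `K(t) = κ(t) + t`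
is nondecreasing on `I`, and such that `[t, K(t)] ⊆ I` for every `t ∈ I`. -/
def IsPreKupisch (I : Set ℝ) (κ : ℝ → ℝ) : Prop :=
  (∀ t ∈ I, 0 < κ t) ∧
  (∀ s ∈ I, ∀ t ∈ I, s ≤ t → κ s + s ≤ κ t + t) ∧
  (∀ t ∈ I, Set.Icc t (κ t + t) ⊆ I)

/-- if `κ` is pre-Kupisch on `I`, `(c − ε, c) ⊆ I` for some `ε > 0`,
and `κ(t) → 0` as `t → c⁻`, then `K(t) ≤ c` for all `t ∈ I` with `t < c`; and if
moreover `K(t₀) = c` for some `t₀ ∈ I` with `t₀ < c`, then `K(t) = c` for every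
`t ∈ [t₀, c)`. -/
theorem preKupisch_le_of_tendsto_zero
    (I : Set ℝ) (hIne : I.Nonempty) (hIoc : I.OrdConnected)
    (κ : ℝ → ℝ) (hκ : IsPreKupisch I κ) (c : ℝ)
    (hleft : ∃ ε > 0, Set.Ioo (c - ε) c ⊆ I)
    (hlim : Filter.Tendsto κ (nhdsWithin c (Set.Iio c)) (nhds 0)) :
    (∀ t ∈ I, t < c → κ t + t ≤ c) ∧
    (∀ t₀ ∈ I, t₀ < c → κ t₀ + t₀ = c → ∀ t ∈ Set.Ico t₀ c, κ t + t = c) := by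
  obtain ⟨-, hmono, hIcc⟩ := hκ
  obtain ⟨ε, hε, hεI⟩ := hleft
  have hK : Filter.Tendsto (fun t => κ t + t) (nhdsWithin c (Set.Iio c)) (nhds c) := by
    simpa using hlim.add (Filter.tendsto_id.mono_left (nhdsWithin_le_nhds (a := c)))
  have hle : ∀ t ∈ I, t < c → κ t + t ≤ c := by
    intro t ht htc
    refine ge_of_tendsto hK ?_
    filter_upwards [Ioo_mem_nhdsLT (sub_lt_self c hε), Ioo_mem_nhdsLT htc] with s hs hts
    exact hmono t ht s (hεI hs) hts.1.le
  refine ⟨hle, fun t₀ ht₀ _ hKt₀ t ht => ?_⟩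
  have htI : t ∈ I := hIcc t₀ ht₀ ⟨ht.1, hKt₀ ▸ ht.2.le⟩
  exact le_antisymm (hle t htI ht.2) (hKt₀ ▸ hmono t₀ ht₀ t htI ht.1)
end

section
/- Let κ be a pre-Kupisch function on an interval I ⊆ ℝ. If c ∈ (t, K(t)) for some t ∈ I, then κ does not tend to 0 as s tends to c from the left (within I). -/
/-- if `κ` is pre-Kupisch on `I` and `c ∈ (t, K(t))` for some `t ∈ I`,
then `κ(s)` does not tend to `0` as `s → c⁻`. -/
theorem not_tendsto_zero_of_mem_Ioo
    (I : Set ℝ) (hIne : I.Nonempty) (hIoc : I.OrdConnected)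
    (κ : ℝ → ℝ) (hκ : IsPreKupisch I κ)
    (t : ℝ) (ht : t ∈ I) (c : ℝ) (hc : c ∈ Set.Ioo t (κ t + t)) :
    ¬ Filter.Tendsto κ (nhdsWithin c (Set.Iio c)) (nhds 0) := by
  obtain ⟨-, hmono, hsub⟩ := hκ
  intro hlim
  have hsmall : ∀ᶠ s in nhdsWithin c (Set.Iio c), κ s < κ t + t - c :=
    hlim.eventually (gt_mem_nhds (sub_pos.mpr hc.2))
  obtain ⟨s, hs, hts, hsc⟩ := (hsmall.and (Ioo_mem_nhdsLT hc.1)).exists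
  have hsI : s ∈ I := hsub t ht ⟨hts.le, (hsc.trans hc.2).le⟩
  linarith [hmono t ht s hsI hts.le]
end

section
/- Let κ be a pre-Kupisch function on an interval I ⊆ ℝ and let a ∈ I. If the sequence of iterates K^n(a) converges as n → ∞ to a point c belonging to I, then c is a separation point of κ and no point of the open interval (a, c) is a separation point of κ. Hence c is the minimum separation point of κ that is greater than a. -/
/-- A separation point of a pre-Kupisch function `κ` on `I`: an interior point `c`
of `I` such that `κ(t) → 0` as `t → c⁻` and `K(t) < c` for all `t ∈ I`, `t < c`. -/
def IsSepPt (I : Set ℝ) (κ : ℝ → ℝ) (c : ℝ) : Prop :=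
  (∃ ε > 0, Set.Ioo (c - ε) (c + ε) ⊆ I) ∧
  Filter.Tendsto κ (nhdsWithin c (Set.Iio c)) (nhds 0) ∧
  (∀ t ∈ I, t < c → κ t + t < c)

/-- if the sequence of iterates `K^[n](a)` converges to a point
`c ∈ I`, then `c` is a separation point of `κ`, no point of `(a, c)` is a
separation point, and `a < c`; hence `c` is the minimum separation point of `κ`
greater than `a`. -/
theorem limit_of_iterates_is_min_sepPt
    (I : Set ℝ) (hIne : I.Nonempty) (hIoc : I.OrdConnected)
    (κ : ℝ → ℝ) (hκ : IsPreKupisch I κ)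
    (a : ℝ) (ha : a ∈ I) (c : ℝ) (hc : c ∈ I)
    (hlim : Filter.Tendsto (fun n : ℕ => (fun t => κ t + t)^[n] a)
      Filter.atTop (nhds c)) :
    a < c ∧ IsSepPt I κ c ∧ ∀ x ∈ Set.Ioo a c, ¬ IsSepPt I κ x := by
  obtain ⟨hpos, hmono, hsub⟩ := hκ
  set K : ℝ → ℝ := fun t => κ t + t
  have hmaps : Set.MapsTo K I I := fun t ht =>
    hsub t ht (Set.right_mem_Icc.2 (by linarith [hpos t ht]))
  have hmem : ∀ n, K^[n] a ∈ I := fun n => hmaps.iterate n ha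
  have hstrict : StrictMono fun n => K^[n] a := by
    refine strictMono_nat_of_lt_succ fun n => ?_
    rw [Function.iterate_succ_apply']
    exact lt_add_of_pos_left _ (hpos _ (hmem n))
  have hlt : ∀ n, K^[n] a < c := fun n =>
    (hstrict n.lt_succ_self).trans_le (hstrict.monotone.ge_of_tendsto hlim _)
  have hac : a < c := hlt 0
  have hKlt : ∀ t ∈ I, t < c → κ t + t < c := by
    intro t ht htc
    obtain ⟨n, hn⟩ := (hlim.eventually_const_lt htc).exists
    have hle : κ t + t ≤ K (K^[n] a) := hmono t ht _ (hmem n) hn.le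
    rw [← Function.iterate_succ_apply' K] at hle
    exact hle.trans_lt (hlt (n + 1))
  refine ⟨hac, ⟨?_, ?_, hKlt⟩, ?_⟩
  · refine ⟨min (c - a) (κ c), lt_min (sub_pos.2 hac) (hpos c hc), fun t ht => ?_⟩
    have hleft := min_le_left (c - a) (κ c)
    have hright := min_le_right (c - a) (κ c)
    rcases le_total t c with htc | hct
    · exact hIoc.out ha hc ⟨by linarith [ht.1], htc⟩
    · exact hsub c hc ⟨hct, by linarith [ht.2]⟩
  · have hdist : Filter.Tendsto (fun t => c - t) (nhdsWithin c (Set.Iio c)) (nhds 0) := by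
      have hcont : Continuous fun t : ℝ => c - t := by fun_prop
      simpa using (hcont.tendsto c).mono_left nhdsWithin_le_nhds
    have hbounds : ∀ᶠ t in nhdsWithin c (Set.Iio c), 0 ≤ κ t ∧ κ t ≤ c - t := by
      filter_upwards [Ioo_mem_nhdsLT hac] with t ht
      have htI : t ∈ I := hIoc.out ha hc (Set.Ioo_subset_Icc_self ht)
      exact ⟨(hpos t htI).le, by linarith [hKlt t htI ht.2]⟩
    exact tendsto_of_tendsto_of_tendsto_of_le_of_le' tendsto_const_nhds hdist
      (hbounds.mono fun _ h => h.1) (hbounds.mono fun _ h => h.2)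
  · rintro x ⟨hax, hxc⟩ ⟨-, -, hx⟩
    have hiter : ∀ n, K^[n] a < x := by
      intro n
      induction n with
      | zero => exact hax
      | succ n ih =>
        rw [Function.iterate_succ_apply']
        exact hx _ (hmem n) ih
    exact hxc.not_ge (le_of_tendsto' hlim fun n => (hiter n).le)
end

section
/- Let κ be a pre-Kupisch function on an interval I ⊆ ℝ with no separation points. Then for every t ∈ I: if I is bounded above, the sequence of iterates K^n(t) converges to sup I as n → ∞; if I is unbounded above, then K^n(t) tends to +∞ as n → ∞. -/
namespace IsPreKupisch

variable {I : Set ℝ} {κ : ℝ → ℝ} {t : ℝ}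

/-- The iterates of `K` starting in `I` stay in `I`. -/
theorem iterate_mem (hκ : IsPreKupisch I κ) (ht : t ∈ I) (n : ℕ) :
    (fun s => κ s + s)^[n] t ∈ I := by
  induction n with
  | zero => exact ht
  | succ n ih =>
    rw [Function.iterate_succ_apply']
    exact hκ.2.2 _ ih ⟨by linarith [hκ.1 _ ih], le_rfl⟩

/-- The iterates of `K` form a strictly increasing sequence. -/
theorem strictMono_iterate (hκ : IsPreKupisch I κ) (ht : t ∈ I) :
    StrictMono (fun n : ℕ => (fun s => κ s + s)^[n] t) := by
  refine strictMono_nat_of_lt_succ fun n => ?_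
  simp only [Function.iterate_succ_apply']
  linarith [hκ.1 _ (hκ.iterate_mem ht n)]

/-- A limit of iterates of `K` that is not an upper bound of `I` is a separation point. -/
theorem isSepPt_of_tendsto_iterate (hκ : IsPreKupisch I κ) (hI : I.OrdConnected) (ht : t ∈ I)
    {c y : ℝ} (hc : Filter.Tendsto (fun n : ℕ => (fun s => κ s + s)^[n] t)
      Filter.atTop (nhds c)) (hy : y ∈ I) (hcy : c < y) : IsSepPt I κ c := by
  have hmono := hκ.strictMono_iterate ht
  have hlt (n : ℕ) : (fun s => κ s + s)^[n] t < c :=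
    (hmono n.lt_succ_self).trans_le (hmono.monotone.ge_of_tendsto hc _)
  have htc : t < c := hlt 0
  have hK : ∀ s ∈ I, s < c → κ s + s < c := by
    intro s hs hsc
    obtain ⟨n, hn⟩ := (hc.eventually (lt_mem_nhds hsc)).exists
    have hle := hκ.2.1 s hs _ (hκ.iterate_mem ht n) hn.le
    have hn' := hlt (n + 1)
    rw [Function.iterate_succ_apply'] at hn'
    exact hle.trans_lt hn'
  refine ⟨⟨min (c - t) (y - c), lt_min (sub_pos.2 htc) (sub_pos.2 hcy), fun s hs => ?_⟩, ?_, hK⟩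
  · refine hI.out ht hy ⟨?_, ?_⟩
    · linarith [hs.1, min_le_left (c - t) (y - c)]
    · linarith [hs.2, min_le_right (c - t) (y - c)]
  · have hsub : Filter.Tendsto (fun s => c - s) (nhdsWithin c (Set.Iio c)) (nhds 0) := by
      have h : Filter.Tendsto (fun s => c - s) (nhds c) (nhds (c - c)) :=
        tendsto_const_nhds.sub Filter.tendsto_id
      rw [sub_self] at h
      exact h.mono_left nhdsWithin_le_nhds
    have hmem : ∀ᶠ s in nhdsWithin c (Set.Iio c), s ∈ I ∧ s < c := by
      filter_upwards [Ioo_mem_nhdsLT htc] with s hs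
      exact ⟨hI.out ht hy ⟨hs.1.le, (hs.2.trans hcy).le⟩, hs.2⟩
    refine tendsto_of_tendsto_of_tendsto_of_le_of_le' tendsto_const_nhds hsub ?_ ?_
    · filter_upwards [hmem] with s hs using (hκ.1 s hs.1).le
    · filter_upwards [hmem] with s hs
      linarith [hK s hs.1 hs.2]

end IsPreKupisch

/-- if `κ` is a pre-Kupisch function on `I` with no separation
points, then for every `t ∈ I` the iterates `K^[n](t)` converge to `sSup I` when
`I` is bounded above, and tend to `+∞` when `I` is unbounded above. -/
theorem iterates_tendsto_sSup_of_no_sepPt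
    (I : Set ℝ) (hIne : I.Nonempty) (hIoc : I.OrdConnected)
    (κ : ℝ → ℝ) (hκ : IsPreKupisch I κ)
    (hsep : ∀ c : ℝ, ¬ IsSepPt I κ c)
    (t : ℝ) (ht : t ∈ I) :
    (BddAbove I →
      Filter.Tendsto (fun n : ℕ => (fun s => κ s + s)^[n] t)
        Filter.atTop (nhds (sSup I))) ∧
    (¬ BddAbove I →
      Filter.Tendsto (fun n : ℕ => (fun s => κ s + s)^[n] t)
        Filter.atTop Filter.atTop) := by
  have hmono := (hκ.strictMono_iterate ht).monotone
  have hub {c : ℝ} (hc : Filter.Tendsto (fun n : ℕ => (fun s => κ s + s)^[n] t)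
      Filter.atTop (nhds c)) : ∀ y ∈ I, y ≤ c := fun y hy =>
    not_lt.1 fun hcy => hsep c (hκ.isSepPt_of_tendsto_iterate hIoc ht hc hy hcy)
  constructor
  · intro hbdd
    have hle (n : ℕ) := le_csSup hbdd (hκ.iterate_mem ht n)
    have hlim := tendsto_atTop_ciSup hmono ⟨sSup I, Set.forall_mem_range.2 hle⟩
    rwa [le_antisymm (ciSup_le hle) (csSup_le hIne (hub hlim))] at hlim
  · intro hbdd
    rcases tendsto_atTop_of_monotone hmono with h | ⟨c, hc⟩
    · exact h
    · exact absurd ⟨c, hub hc⟩ hbdd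
end

section
/- Let n ≥ 1 and let l : ℤ → ℤ satisfy l(i + n) = l(i), l(i) ≥ 1, and l(i) ≤ l(i + 1) + 1 for all i ∈ ℤ. Define κ_A : ℝ → ℝ by κ_A(t) = (i + l(i))/n − t for t ∈ [i/n, (i+1)/n), i ∈ ℤ. Then κ_A is a Kupisch function, and κ_A has no separation points. -/
/-- A Kupisch function: a pre-Kupisch function on all of ℝ (positive, with
`K(t) = κ(t) + t` nondecreasing) which is `1`-periodic. -/
def IsKupisch (κ : ℝ → ℝ) : Prop :=
  (∀ t, 0 < κ t) ∧ (Monotone fun t => κ t + t) ∧ (∀ t, κ (t + 1) = κ t)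

/-- A separation point of a (pre-)Kupisch function `κ` on ℝ: a point `c` such that
`κ(t) → 0` as `t → c⁻` and `K(t) < c` for all `t < c`. -/
def IsSepPtR (κ : ℝ → ℝ) (c : ℝ) : Prop :=
  Filter.Tendsto κ (nhdsWithin c (Set.Iio c)) (nhds 0) ∧
  (∀ t < c, κ t + t < c)

/-- The Kupisch function associated to an `n`-periodic Kupisch series `l`:
`κ_A(t) = (i + l(i))/n − t` for `t ∈ [i/n, (i+1)/n)`, where `i = ⌊n·t⌋`. -/
noncomputable def assocKupisch (n : ℕ) (l : ℤ → ℤ) : ℝ → ℝ :=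
  fun t => ((⌊(n : ℝ) * t⌋ + l ⌊(n : ℝ) * t⌋ : ℤ) : ℝ) / n - t

theorem assocKupisch_add_self (n : ℕ) (l : ℤ → ℤ) (t : ℝ) :
    assocKupisch n l t + t = ((⌊(n : ℝ) * t⌋ + l ⌊(n : ℝ) * t⌋ : ℤ) : ℝ) / n :=
  sub_add_cancel _ _

theorem isKupisch_assocKupisch {n : ℕ} (hn : 1 ≤ n) {l : ℤ → ℤ}
    (hper : ∀ i, l (i + (n : ℤ)) = l i) (hpos : ∀ i, 1 ≤ l i)
    (hstep : ∀ i, l i ≤ l (i + 1) + 1) : IsKupisch (assocKupisch n l) := by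
  have hn0 : (0 : ℝ) < n := by exact_mod_cast hn
  refine ⟨fun t => ?_, fun s t hst => ?_, fun t => ?_⟩
  · have h := Int.lt_floor_add_one ((n : ℝ) * t)
    have h1 : (1 : ℝ) ≤ l ⌊(n : ℝ) * t⌋ := by exact_mod_cast hpos _
    rw [assocKupisch, sub_pos, lt_div_iff₀ hn0]
    push_cast
    linarith
  · have hmono : Monotone fun i : ℤ => i + l i :=
      monotone_int_of_le_succ fun i => by linarith [hstep i]
    simp only [assocKupisch_add_self]
    have hfloor : ⌊(n : ℝ) * s⌋ ≤ ⌊(n : ℝ) * t⌋ := by gcongr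
    have := hmono hfloor
    gcongr
  · have hfloor : ⌊(n : ℝ) * (t + 1)⌋ = ⌊(n : ℝ) * t⌋ + n := by
      rw [mul_add, mul_one, Int.floor_add_natCast]
    simp only [assocKupisch, hfloor, hper]
    push_cast
    field_simp
    ring

theorem not_isSepPtR_assocKupisch {n : ℕ} (hn : 1 ≤ n) {l : ℤ → ℤ}
    (hpos : ∀ i, 1 ≤ l i) (c : ℝ) : ¬ IsSepPtR (assocKupisch n l) c := by
  rintro ⟨-, hsep⟩
  have hn0 : (0 : ℝ) < n := by exact_mod_cast hn
  set i : ℤ := ⌈(n : ℝ) * c⌉ - 1 with hi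
  have hlt : (i : ℝ) / n < c := by
    rw [div_lt_iff₀ hn0, hi]
    push_cast
    linarith [Int.ceil_lt_add_one ((n : ℝ) * c)]
  have h := hsep _ hlt
  rw [assocKupisch_add_self, mul_div_cancel₀ _ hn0.ne', Int.floor_intCast,
    div_lt_iff₀ hn0] at h
  have h1 : (1 : ℝ) ≤ l i := by exact_mod_cast hpos i
  have h2 : (n : ℝ) * c ≤ i + 1 := by
    rw [hi]
    push_cast
    linarith [Int.le_ceil ((n : ℝ) * c)]
  push_cast at h
  linarith

/-- if `n ≥ 1` and `l : ℤ → ℤ` satisfies `l(i+n) = l(i)`,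
`l(i) ≥ 1` and `l(i) ≤ l(i+1) + 1` for all `i` (the conditions satisfied by the
Kupisch series of a basic connected Nakayama algebra), then the associated
function `κ_A` is a Kupisch function with no separation points. -/
theorem assocKupisch_isKupisch_and_no_sepPt
    (n : ℕ) (hn : 1 ≤ n) (l : ℤ → ℤ)
    (hper : ∀ i, l (i + (n : ℤ)) = l i)
    (hpos : ∀ i, 1 ≤ l i)
    (hstep : ∀ i, l i ≤ l (i + 1) + 1) :
    IsKupisch (assocKupisch n l) ∧ ∀ c : ℝ, ¬ IsSepPtR (assocKupisch n l) c :=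
  ⟨isKupisch_assocKupisch hn hper hpos hstep, not_isSepPtR_assocKupisch hn hpos⟩
end

section
/- Let κ be a pre-Kupisch function on an interval I ⊆ ℝ with no separation points, and let a < b be points of I. Then there exists a natural number n ≥ 1 such that K^{n−1}(a) < b ≤ K^n(a), where K^m denotes the m-fold iterate of K. -/
/-- For a pre-Kupisch function `κ` with `K(t) = κ(t) + t`, a supremum `c` of the `K`-orbit of a
point `a` is a separation point as soon as the orbit stays below a point `b` of the interval. -/
theorem IsPreKupisch.isSepPt_of_isLUB_orbit {I : Set ℝ} (hIoc : I.OrdConnected) {κ : ℝ → ℝ}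
    (hκ : IsPreKupisch I κ) {a b c : ℝ} (ha : a ∈ I) (hb : b ∈ I)
    (hlt : ∀ n : ℕ, (fun t => κ t + t)^[n] a < b)
    (hc : IsLUB (Set.range fun n : ℕ => (fun t => κ t + t)^[n] a) c) : IsSepPt I κ c := by
  obtain ⟨hpos, hmono, hsub⟩ := hκ
  have hmem (n : ℕ) : (fun t => κ t + t)^[n] a ∈ I := by
    induction n with
    | zero => exact ha
    | succ n ih =>
      rw [Function.iterate_succ_apply']
      exact hsub _ ih ⟨by linarith [hpos _ ih], le_rfl⟩
  have hltc (n : ℕ) : (fun t => κ t + t)^[n] a < c := by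
    have h := hc.1 ⟨n + 1, rfl⟩
    simp only [Function.iterate_succ_apply'] at h
    linarith [hpos _ (hmem n)]
  have hcb : c ≤ b := hc.2 (by rintro _ ⟨n, rfl⟩; exact (hlt n).le)
  have hac : a < c := hltc 0
  have hKc : ∀ t ∈ I, t < c → κ t + t < c := by
    intro t ht htc
    obtain ⟨_, ⟨n, rfl⟩, hn, -⟩ := hc.exists_between htc
    refine (hmono t ht _ (hmem n) hn.le).trans_lt ?_
    simpa only [Function.iterate_succ_apply'] using hltc (n + 1)
  have hKb : κ b + b ∈ I := hsub b hb ⟨by linarith [hpos b hb], le_rfl⟩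
  refine ⟨⟨min (c - a) (κ b), lt_min (by linarith) (hpos b hb), ?_⟩, ?_, hKc⟩
  · rintro t ⟨h₁, h₂⟩
    have := min_le_left (c - a) (κ b)
    have := min_le_right (c - a) (κ b)
    exact hIoc.out ha hKb ⟨by linarith, by linarith⟩
  · have hlim : Filter.Tendsto (fun t => c - t) (nhdsWithin c (Set.Iio c)) (nhds 0) := by
      have h : Filter.Tendsto (fun t => c - t) (nhds c) (nhds (c - c)) :=
        (continuous_const.sub continuous_id).tendsto c
      rw [sub_self] at h
      exact h.mono_left nhdsWithin_le_nhds
    have hnear : ∀ᶠ t in nhdsWithin c (Set.Iio c), t ∈ I ∧ t < c := by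
      filter_upwards [Ioo_mem_nhdsLT hac] with t ht
      exact ⟨hIoc.out ha hb ⟨ht.1.le, ht.2.le.trans hcb⟩, ht.2⟩
    refine tendsto_of_tendsto_of_tendsto_of_le_of_le' tendsto_const_nhds hlim ?_ ?_
    · filter_upwards [hnear] with t ht
      exact (hpos t ht.1).le
    · filter_upwards [hnear] with t ht
      linarith [hKc t ht.1 ht.2]

/-- if `κ` is a pre-Kupisch function on `I` with no separation
points and `a < b` in `I`, then there is `n ≥ 1` with
`K^[n−1](a) < b ≤ K^[n](a)`. -/
theorem exists_iterate_straddling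
    (I : Set ℝ) (hIne : I.Nonempty) (hIoc : I.OrdConnected)
    (κ : ℝ → ℝ) (hκ : IsPreKupisch I κ)
    (hsep : ∀ c : ℝ, ¬ IsSepPt I κ c)
    (a b : ℝ) (ha : a ∈ I) (hb : b ∈ I) (hab : a < b) :
    ∃ n : ℕ, 1 ≤ n ∧ (fun t => κ t + t)^[n - 1] a < b ∧
      b ≤ (fun t => κ t + t)^[n] a := by
  classical
  have hex : ∃ n : ℕ, b ≤ (fun t => κ t + t)^[n] a := by
    by_contra! hlt
    exact hsep _ (hκ.isSepPt_of_isLUB_orbit hIoc ha hb hlt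
      (isLUB_ciSup ⟨b, by rintro _ ⟨n, rfl⟩; exact (hlt n).le⟩))
  have hn : 1 ≤ Nat.find hex := by
    rw [Nat.one_le_iff_ne_zero]
    intro h
    have hle := Nat.find_spec hex
    rw [h] at hle
    exact hab.not_ge hle
  exact ⟨Nat.find hex, hn, not_le.mp (Nat.find_min hex (by lia)), Nat.find_spec hex⟩
end
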